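/- arXiv:2112.10445 — 3 statements merged into one kernel-verified Lean document; each statement's English description precedes it below -/
import Mathlib

section
/- For every claim-augmented argumentation framework F, every claim-set in the claim-level naive semantics is also in the inherited naive semantics, i.e. cl-naive(F) ⊆ na_c(F). -/
/-- A set `E` of arguments is conflict-free w.r.t. attack relation `R`:
no argument in `E` attacks another argument in `E`. -/
def ConflictFree {α : Type*} (R : α → α → Prop) (E : Set α) : Prop :=
  ∀ a ∈ E, ∀ b ∈ E, ¬ R a b

/-- A set `E` is naive iff it is ⊆-maximal among conflict-free sets. -/
def Naive {α : Type*} (R : α → α → Prop) (E : Set α) : Prop :=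
  ConflictFree R E ∧ ∀ E', ConflictFree R E' → E ⊆ E' → E' = E

/-- Inherited naive semantics: claim-sets of naive extensions. -/
def naC {α γ : Type*} (R : α → α → Prop) (cl : α → γ) : Set (Set γ) :=
  {S | ∃ E, Naive R E ∧ S = cl '' E}

/-- Claim-sets of conflict-free sets. -/
def cfC {α γ : Type*} (R : α → α → Prop) (cl : α → γ) : Set (Set γ) :=
  {S | ∃ E, ConflictFree R E ∧ S = cl '' E}

/-- Claim-level naive semantics: ⊆-maximal claim-sets of conflict-free sets. -/
def clNaive {α γ : Type*} (R : α → α → Prop) (cl : α → γ) : Set (Set γ) :=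
  {S | S ∈ cfC R cl ∧ ∀ T ∈ cfC R cl, S ⊆ T → T = S}

/-- A family of sets is incomparable if no member is a strict subset of another. -/
def Incomparable {γ : Type*} (S : Set (Set γ)) : Prop :=
  ∀ S1 ∈ S, ∀ S2 ∈ S, ¬ S1 ⊂ S2

/-- For every CAF, `cl-naive(F) ⊆ na_c(F)`. -/
theorem clNaive_subset_naC {α γ : Type*} [Fintype α]
    (R : α → α → Prop) (cl : α → γ) :
    clNaive R cl ⊆ naC R cl := by
  rintro S ⟨⟨E, hE, rfl⟩, hmax⟩
  obtain ⟨M, hEM, hM⟩ :=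
    (Set.toFinite {E' : Set α | ConflictFree R E'}).exists_le_maximal hE
  refine ⟨M, ⟨hM.prop, fun E' hE' hME' => (hM.eq_of_le hE' hME').symm⟩, ?_⟩
  exact (hmax (cl '' M) ⟨M, hM.prop, rfl⟩ (Set.image_mono hEM)).symm
end

section
/- If the CNF formula φ is unsatisfiable (and no clause of φ contains both a literal and its negation), then the family na_c(F_φ) of claim-sets of naive extensions of the reduction CAF F_φ is incomparable: for all naive extensions E, E' of F_φ, cl(E') is not a strict subset of cl(E). Consequently na_c(F_φ) = cl-naive(F_φ). -/
/-- Arguments of the reduction CAF `F_φ` for a CNF formula over atoms `X`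
with clause index set `I`: an argument `pos x` for each atom `x`, an argument
`neg x` (i.e. `x̄`) for each atom, an argument `cls i` for each clause,
and the arguments `φ`, `a1`, `a2`. -/
inductive RArg (X I : Type*) where
  | pos : X → RArg X I
  | neg : X → RArg X I
  | cls : I → RArg X I
  | phi : RArg X I
  | a1 : RArg X I
  | a2 : RArg X I

/-- Claims of the reduction CAF: each atom argument, negated-atom argument,
clause argument and `φ` has its own claim; `a1` and `a2` share the fresh claim `a`. -/
inductive RClaim (X I : Type*) where
  | pos : X → RClaim X I
  | neg : X → RClaim X I
  | cls : I → RClaim X I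
  | phi : RClaim X I
  | a : RClaim X I

/-- The claim function of the reduction CAF. -/
def rcl {X I : Type*} : RArg X I → RClaim X I
  | .pos x => .pos x
  | .neg x => .neg x
  | .cls i => .cls i
  | .phi => .phi
  | .a1 => .a
  | .a2 => .a

/-- The attack relation of the reduction CAF, where clause `i` has positive
literals `P i` and negative literals `N i`:  `x` attacks clause `i` if `x ∈ P i`,
`x̄` attacks clause `i` if `¬x ∈ cl_i` (i.e. `x ∈ N i`), `x` and `x̄` attack each
other, every clause attacks `φ`, and `φ` attacks `a2`. -/
def rAtt {X I : Type*} (P N : I → Set X) : RArg X I → RArg X I → Prop := fun u v =>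
  match u, v with
  | .pos x, .cls i => x ∈ P i
  | .neg x, .cls i => x ∈ N i
  | .pos x, .neg y => x = y
  | .neg x, .pos y => x = y
  | .cls _, .phi => True
  | .phi, .a2 => True
  | _, _ => False

/-- No clause contains both a literal and its negation. -/
def NonTaut {X I : Type*} (P N : I → Set X) : Prop :=
  ∀ i : I, ∀ x : X, ¬ (x ∈ P i ∧ x ∈ N i)

/-- `M ⊆ X` is a model of the CNF formula: every clause contains a positive
literal in `M` or a negative literal whose atom is not in `M`. -/
def IsModel {X I : Type*} (P N : I → Set X) (M : Set X) : Prop :=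
  ∀ i : I, (∃ x ∈ P i, x ∈ M) ∨ (∃ x ∈ N i, x ∉ M)

/-- The formula is satisfiable if it has a model. -/
def Satisfiable {X I : Type*} (P N : I → Set X) : Prop :=
  ∃ M : Set X, IsModel P N M

/-- The naive extension `E = M ∪ {x̄ : x ∉ M} ∪ {φ, a1}` built from a model `M`. -/
def Ephi {X I : Type*} (M : Set X) : Set (RArg X I) :=
  (RArg.pos '' M) ∪ (RArg.neg '' Mᶜ) ∪ {RArg.phi, RArg.a1}

/-- The naive extension `E' = M ∪ {x̄ : x ∉ M} ∪ {a1, a2}` built from a model `M`. -/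
def Ea {X I : Type*} (M : Set X) : Set (RArg X I) :=
  (RArg.pos '' M) ∪ (RArg.neg '' Mᶜ) ∪ {RArg.a1, RArg.a2}

theorem ConflictFree.exists_naive_superset {α : Type*} {R : α → α → Prop} {E : Set α}
    (hE : ConflictFree R E) : ∃ F, Naive R F ∧ E ⊆ F := by
  obtain ⟨F, hEF, hF⟩ := zorn_subset_nonempty {G | ConflictFree R G} (by
    intro c hc hchain _
    refine ⟨⋃₀ c, ?_, fun s hs => Set.subset_sUnion_of_mem hs⟩
    rintro a ⟨s, hs, has⟩ b ⟨t, ht, hbt⟩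
    rcases hchain.total hs ht with h | h
    · exact hc ht a (h has) b hbt
    · exact hc hs a has b (h hbt)) E hE
  exact ⟨F, ⟨hF.1, fun G hG hFG => (hF.eq_of_subset hG hFG).symm⟩, hEF⟩

theorem Naive.mem_of_forall_not_attack {α : Type*} {R : α → α → Prop} {E : Set α}
    (hE : Naive R E) {a : α} (haa : ¬ R a a) (h : ∀ b ∈ E, ¬ R a b ∧ ¬ R b a) : a ∈ E := by
  have hcf : ConflictFree R (insert a E) := by
    rintro b (rfl | hb) c (rfl | hc)
    · exact haa
    · exact (h c hc).1
    · exact (h b hb).2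
    · exact hE.1 b hb c hc
  rw [← hE.2 _ hcf (Set.subset_insert a E)]
  exact Set.mem_insert a E

/-- An incomparable inherited naive semantics coincides with the claim-level one. -/
theorem naC_eq_clNaive_of_incomparable {α γ : Type*} {R : α → α → Prop} {cl : α → γ}
    (h : Incomparable (naC R cl)) : naC R cl = clNaive R cl := by
  ext S
  constructor
  · rintro ⟨E, hE, rfl⟩
    refine ⟨⟨E, hE.1, rfl⟩, ?_⟩
    rintro _ ⟨T, hT, rfl⟩ hET
    obtain ⟨F, hF, hTF⟩ := hT.exists_naive_superset
    have hsub := Set.image_mono (f := cl) hTF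
    by_contra hne
    exact h _ ⟨E, hE, rfl⟩ _ ⟨F, hF, rfl⟩
      ((hET.ssubset_of_ne (Ne.symm hne)).trans_subset hsub)
  · rintro ⟨⟨E, hE, rfl⟩, hmax⟩
    obtain ⟨F, hF, hEF⟩ := hE.exists_naive_superset
    exact ⟨F, hF, (hmax _ ⟨F, hF.1, rfl⟩ (Set.image_mono hEF)).symm⟩

section Reduction

variable {X I : Type*} {P N : I → Set X} {E : Set (RArg X I)}

theorem Naive.a1_mem (hE : Naive (rAtt P N) E) : RArg.a1 ∈ E :=
  hE.mem_of_forall_not_attack (by simp [rAtt]) (by rintro (_ | _ | _ | _ | _ | _) _ <;> simp [rAtt])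

theorem Naive.a2_mem (hE : Naive (rAtt P N) E) (hphi : RArg.phi ∉ E) : RArg.a2 ∈ E :=
  hE.mem_of_forall_not_attack (by simp [rAtt])
    (by rintro (_ | _ | _ | _ | _ | _) hb <;> simp_all [rAtt])

/-- Without `φ` and clause arguments, the literals of a naive extension form a model. -/
theorem Naive.isModel (hE : Naive (rAtt P N) E) (hphi : RArg.phi ∉ E)
    (hcls : ∀ i, RArg.cls i ∉ E) : IsModel P N {x | RArg.pos x ∈ E} := by
  intro i
  by_contra! hi
  refine hcls i (hE.mem_of_forall_not_attack (by simp [rAtt]) ?_)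
  rintro (x | x | _ | _ | _ | _) hb
  · exact ⟨by simp [rAtt], fun hx => hi.1 x hx hb⟩
  · exact ⟨by simp [rAtt], fun hx => hE.1 _ (hi.2 x hx) _ hb rfl⟩
  all_goals simp_all [rAtt]

theorem Naive.subset_of_image_subset {E' : Set (RArg X I)} (hE : Naive (rAtt P N) E)
    (ha2 : RArg.a2 ∈ E' → RArg.a2 ∈ E) (h : rcl '' E' ⊆ rcl '' E) : E' ⊆ E := by
  intro u hu
  obtain ⟨v, hv, hvu⟩ := h ⟨u, hu, rfl⟩
  have := hE.a1_mem
  cases u <;> cases v <;> simp_all [rcl]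

theorem not_image_ssubset_of_unsat (hUnsat : ¬ Satisfiable P N) {E' : Set (RArg X I)}
    (hE : Naive (rAtt P N) E) (hE' : Naive (rAtt P N) E') : ¬ rcl '' E' ⊂ rcl '' E := by
  intro h
  by_cases ha2 : RArg.a2 ∈ E' → RArg.a2 ∈ E
  · have := hE'.2 E hE.1 (hE.subset_of_image_subset ha2 h.1)
    exact h.ne (by rw [this])
  · push Not at ha2
    have hphi : RArg.phi ∈ E := by_contra fun hn => ha2.2 (hE.a2_mem hn)
    refine hUnsat ⟨_, hE'.isModel (fun hp => hE'.1 _ hp _ ha2.1 trivial) fun i hi => ?_⟩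
    obtain ⟨v, hv, hvi⟩ := h.1 ⟨_, hi, rfl⟩
    cases v <;> simp only [rcl, reduceCtorEq] at hvi
    exact hE.1 _ hv _ hphi trivial

end Reduction

/-- If `φ` is unsatisfiable (and non-tautological), then
`na_c(F_φ)` is incomparable: for all naive extensions `E`, `E'`, `cl(E')` is
not a strict subset of `cl(E)`; consequently `na_c(F_φ) = cl-naive(F_φ)`. -/
theorem unsat_concurrent {X I : Type*} [Fintype X] [Fintype I]
    (P N : I → Set X) (hNT : NonTaut P N) (hUnsat : ¬ Satisfiable P N) :
    (∀ E E' : Set (RArg X I), Naive (rAtt P N) E → Naive (rAtt P N) E' →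
      ¬ rcl '' E' ⊂ rcl '' E) ∧
    Incomparable (naC (rAtt P N) rcl) ∧
    naC (rAtt P N) rcl = clNaive (rAtt P N) rcl := by
  have hinc : Incomparable (naC (rAtt P N) (rcl (X := X))) := by
    rintro _ ⟨E', hE', rfl⟩ _ ⟨E, hE, rfl⟩
    exact not_image_ssubset_of_unsat hUnsat hE hE'
  exact ⟨fun E E' hE hE' => not_image_ssubset_of_unsat hUnsat hE hE', hinc,
    naC_eq_clNaive_of_incomparable hinc⟩
end

section
/- If E is a naive extension of the reduction CAF F_φ with φ ∈ E, then there is no naive extension E' of F_φ with cl(E) ⊊ cl(E'). -/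
/-- A naive set contains every argument that is not in conflict with itself or with the set. -/
theorem Naive.mem_of_forall_not {α : Type*} {R : α → α → Prop} {E : Set α} (hE : Naive R E)
    {a : α} (ha : ¬ R a a) (h : ∀ b ∈ E, ¬ R a b ∧ ¬ R b a) : a ∈ E := by
  rw [← hE.2 (insert a E) ?_ (Set.subset_insert a E)]
  · exact Set.mem_insert a E
  · rintro b (rfl | hb) c (rfl | hc)
    · exact ha
    · exact (h c hc).1
    · exact (h b hb).2
    · exact hE.1 b hb c hc

/-- If `E` is a naive extension of `F_φ` with `φ ∈ E`, then there
is no naive extension `E'` with `cl(E) ⊊ cl(E')`. -/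
theorem no_strict_superset_of_phi_extension {X I : Type*} [Fintype X] [Fintype I]
    (P N : I → Set X) (hNT : NonTaut P N)
    (E : Set (RArg X I)) (hE : Naive (rAtt P N) E) (hphi : RArg.phi ∈ E) :
    ¬ ∃ E' : Set (RArg X I), Naive (rAtt P N) E' ∧ rcl '' E ⊂ rcl '' E' := by
  rintro ⟨E', hE', hsub, hnot⟩
  have hcls : ∀ i, RArg.cls i ∉ E := fun i hi => hE.1 _ hi _ hphi trivial
  have ha1 : RArg.a1 ∈ E := hE.mem_of_forall_not id fun b _ => by
    cases b <;> exact ⟨id, id⟩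
  have hpos : ∀ x, RArg.neg x ∉ E → RArg.pos x ∈ E := fun x hx =>
    hE.mem_of_forall_not id fun b hb => by
      cases b <;> simp only [rAtt] <;> grind
  have hneg : ∀ x, RArg.pos x ∉ E → RArg.neg x ∈ E := fun x hx => by
    by_contra h
    exact hx (hpos x h)
  have hpos' : ∀ x, RArg.pos x ∈ E → RArg.pos x ∈ E' := fun x hx => by
    obtain ⟨b, hb, hbx⟩ := hsub ⟨_, hx, rfl⟩
    cases b <;> simp_all [rcl]
  have hneg' : ∀ x, RArg.neg x ∈ E → RArg.neg x ∈ E' := fun x hx => by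
    obtain ⟨b, hb, hbx⟩ := hsub ⟨_, hx, rfl⟩
    cases b <;> simp_all [rcl]
  have hphi' : RArg.phi ∈ E' := by
    obtain ⟨b, hb, hbx⟩ := hsub ⟨_, hphi, rfl⟩
    cases b <;> simp_all [rcl]
  refine hnot ?_
  rintro _ ⟨b, hb, rfl⟩
  cases b with
  | pos x =>
    refine ⟨_, hpos x fun h => ?_, rfl⟩
    exact hE'.1 _ hb _ (hneg' x h) rfl
  | neg x =>
    refine ⟨_, hneg x fun h => ?_, rfl⟩
    exact hE'.1 _ hb _ (hpos' x h) rfl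
  | cls i => exact (hE'.1 _ hb _ hphi' trivial).elim
  | phi => exact ⟨_, hphi, rfl⟩
  | a1 => exact ⟨_, ha1, rfl⟩
  | a2 => exact ⟨_, ha1, rfl⟩
end
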